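/- Let F_q be a finite field with q elements and d ≥ 1 an integer. The number of pairs (P, Q) of polynomials in F_q[y] such that P is monic of degree d with P(0) ≠ 0, Q has degree < d, and P and Q are coprime, equals (q−1)² · (q^{2d} − 1)/(q² − 1). -/

import Mathlib

open Polynomial in
/-- monic of degree `k` with nonzero constant term -/
abbrev CcpM (F : Type*) [Field F] (k : ℕ) : Type _ :=
  {P : F[X] // P.Monic ∧ P.natDegree = k ∧ P.eval 0 ≠ 0}

open Polynomial in
/-- coprime pairs -/
abbrev CcpC (F : Type*) [Field F] (d : ℕ) : Type _ :=
  {PQ : F[X] × F[X] //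
        PQ.1.Monic ∧ PQ.1.natDegree = d ∧ PQ.1.eval 0 ≠ 0 ∧
          PQ.2.degree < d ∧ IsCoprime PQ.1 PQ.2}

open Polynomial in
theorem ccp_card_degreeLT (F : Type*) [Field F] [Fintype F] (d : ℕ) :
    Nat.card (degreeLT F d) = Fintype.card F ^ d := by
  rw [Nat.card_congr (degreeLTEquiv F d).toEquiv]
  simp

open Polynomial in
theorem ccp_finite_degreeLT (F : Type*) [Field F] [Fintype F] (d : ℕ) :
    Finite (degreeLT F d) :=
  Finite.of_equiv _ (degreeLTEquiv F d).symm.toEquiv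

open Polynomial in
theorem ccp_card_M_zero (F : Type*) [Field F] : Nat.card (CcpM F 0) = 1 := by
  rw [Nat.card_eq_one_iff_unique]
  refine ⟨⟨fun a b => ?_⟩, ⟨⟨1, monic_one, natDegree_one, by simp⟩⟩⟩
  apply Subtype.ext
  rw [a.2.1.natDegree_eq_zero.mp a.2.2.1, b.2.1.natDegree_eq_zero.mp b.2.2.1]

open Polynomial in
theorem ccp_card_M_succ (F : Type*) [Field F] [Fintype F] (k : ℕ) :
    Nat.card (CcpM F (k + 1)) = (Fintype.card F - 1) * Fintype.card F ^ k := by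
  have key : ∀ (c : F) (R : F[X]), R.Monic → R.natDegree = k →
      (R * X + C c).Monic ∧ (R * X + C c).natDegree = k + 1 := by
    intro c R hR hk
    have h1 : (R * X).natDegree = k + 1 := by rw [natDegree_mul_X hR.ne_zero, hk]
    refine ⟨?_, by rw [natDegree_add_C, h1]⟩
    apply Monic.add_of_left (hR.mul monic_X)
    refine lt_of_le_of_lt degree_C_le ?_
    rw [← natDegree_pos_iff_degree_pos, h1]
    omega
  let f : Fˣ × {R : F[X] // R.Monic ∧ R.natDegree = k} → CcpM F (k + 1) := fun x =>
    ⟨x.2.1 * X + C (x.1 : F), (key _ _ x.2.2.1 x.2.2.2).1, (key _ _ x.2.2.1 x.2.2.2).2, by simp⟩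
  have hf : Function.Bijective f := by
    constructor
    · rintro ⟨c, R, hR⟩ ⟨c', R', hR'⟩ h
      have h1 : R * X + C (c : F) = R' * X + C (c' : F) := congrArg Subtype.val h
      have h2 : (c : F) = c' := by simpa using congrArg (eval 0) h1
      rw [h2] at h1
      have h3 : R = R' := mul_right_cancel₀ X_ne_zero (add_right_cancel h1)
      subst h3
      rw [Units.ext h2]
    · rintro ⟨P, hP, hk, h0⟩
      have e := divX_mul_X_add P
      have h0' : P.coeff 0 ≠ 0 := by rwa [coeff_zero_eq_eval_zero]
      have hd : P.divX.natDegree = k := by rw [natDegree_divX_eq_natDegree_tsub_one, hk]; rfl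
      have hm : P.divX.Monic := by
        rw [Monic, leadingCoeff, hd, coeff_divX, ← hk]; exact hP
      exact ⟨⟨Units.mk0 _ h0', P.divX, hm, hd⟩, Subtype.ext e⟩
  rw [← Nat.card_congr (Equiv.ofBijective f hf), Nat.card_prod, Nat.card_congr
    (monicEquivDegreeLT k), ccp_card_degreeLT, Nat.card_units, Nat.card_eq_fintype_card]

theorem ccp_finite_M (F : Type*) [Field F] [Fintype F] (k : ℕ) : Finite (CcpM F k) := by
  have : 1 < Fintype.card F := Fintype.one_lt_card
  apply Nat.finite_of_card_ne_zero
  rcases k with _ | k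
  · rw [ccp_card_M_zero]; exact one_ne_zero
  · rw [ccp_card_M_succ]
    have : 0 < Fintype.card F - 1 := by omega
    positivity

open Polynomial in
theorem ccp_finite_C (F : Type*) [Field F] [Fintype F] (k : ℕ) : Finite (CcpC F k) := by
  have := ccp_finite_M F k
  have := ccp_finite_degreeLT F k
  let f : CcpC F k → CcpM F k × degreeLT F k := fun x =>
    (⟨x.1.1, x.2.1, x.2.2.1, x.2.2.2.1⟩, ⟨x.1.2, mem_degreeLT.mpr x.2.2.2.2.1⟩)
  apply Finite.of_injective f
  rintro ⟨⟨a, b⟩, h⟩ ⟨⟨a', b'⟩, h'⟩ e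
  have e1 := congrArg (fun z => z.1.1) e
  have e2 := congrArg (fun z => z.2.1) e
  simp only [f] at e1 e2
  subst e1 e2
  rfl

open Polynomial in
theorem ccp_conv (F : Type*) [Field F] [Fintype F] (d : ℕ) :
    Nat.card (CcpM F d) * Fintype.card F ^ d =
      ∑ k ∈ Finset.range (d + 1), Nat.card (CcpM F k) * Nat.card (CcpC F (d - k)) := by
  have hfM := ccp_finite_M F
  have hfC := ccp_finite_C F
  let f : (Σ k : Fin (d + 1), CcpM F k × CcpC F (d - k)) → CcpM F d × degreeLT F d := fun x =>
    (⟨x.2.1.1 * x.2.2.1.1, x.2.1.2.1.mul x.2.2.2.1, by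
        rw [x.2.1.2.1.natDegree_mul x.2.2.2.1, x.2.1.2.2.1, x.2.2.2.2.1]; omega, by
        rw [eval_mul]; exact mul_ne_zero x.2.1.2.2.2 x.2.2.2.2.2.1⟩,
     ⟨x.2.1.1 * x.2.2.1.2, by
        rw [mem_degreeLT]
        by_cases h0 : x.2.2.1.2 = 0
        · rw [h0, mul_zero, degree_zero]; exact WithBot.bot_lt_coe d
        · have h := x.2.2.2.2.2.2.1
          rw [degree_eq_natDegree h0] at h
          have h' : x.2.2.1.2.natDegree < d - x.1 := by exact_mod_cast h
          rw [degree_eq_natDegree (mul_ne_zero x.2.1.2.1.ne_zero h0),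
            natDegree_mul x.2.1.2.1.ne_zero h0, x.2.1.2.2.1]
          have : (x.1 : ℕ) + x.2.2.1.2.natDegree < d := by omega
          exact_mod_cast this⟩)
  have hdvd : ∀ (G G' P P' Q Q' : F[X]), IsCoprime P Q → G * P = G' * P' → G * Q = G' * Q' →
      G' ∣ G := by
    rintro G G' P P' Q Q' ⟨a, b, h⟩ h1 h2
    refine ⟨a * P' + b * Q', ?_⟩
    linear_combination (-G) * h + a * h1 + b * h2
  have hf : Function.Bijective f := by
    constructor
    · rintro ⟨k, ⟨G, hG⟩, ⟨⟨P, Q⟩, hPQ⟩⟩ ⟨k', ⟨G', hG'⟩, ⟨⟨P', Q'⟩, hPQ'⟩⟩ e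
      have e1 : G * P = G' * P' := congrArg (fun z => z.1.1) e
      have e2 : G * Q = G' * Q' := congrArg (fun z => z.2.1) e
      have hGG : G = G' := eq_of_monic_of_associated hG.1 hG'.1
        (associated_of_dvd_dvd (hdvd _ _ _ _ _ _ hPQ'.2.2.2.2 e1.symm e2.symm)
          (hdvd _ _ _ _ _ _ hPQ.2.2.2.2 e1 e2))
      subst hGG
      have hk : k = k' := Fin.ext (hG.2.1.symm.trans hG'.2.1)
      subst hk
      have e3 : P = P' := mul_left_cancel₀ hG.1.ne_zero e1
      have e4 : Q = Q' := mul_left_cancel₀ hG.1.ne_zero e2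
      subst e3 e4
      rfl
    · rintro ⟨⟨P, hP, hd, h0⟩, ⟨Q, hQ⟩⟩
      rw [mem_degreeLT] at hQ
      classical
      obtain ⟨G, hG, P', Q', rfl, rfl, hc⟩ : ∃ G : F[X], G.Monic ∧ ∃ P' Q', P = G * P' ∧
          Q = G * Q' ∧ IsCoprime P' Q' := by
        have hg0 : EuclideanDomain.gcd P Q ≠ 0 := fun h =>
          hP.ne_zero (EuclideanDomain.gcd_eq_zero_iff.mp h).1
        have ha : Associated (normalize (EuclideanDomain.gcd P Q)) (EuclideanDomain.gcd P Q) :=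
          normalize_associated _
        have hm := monic_normalize hg0
        obtain ⟨P', hP'⟩ := ha.dvd.trans (EuclideanDomain.gcd_dvd_left P Q)
        obtain ⟨Q', hQ'⟩ := ha.dvd.trans (EuclideanDomain.gcd_dvd_right P Q)
        refine ⟨_, hm, P', Q', hP', hQ', ?_⟩
        obtain ⟨u, hu⟩ := ha.symm.dvd
        have hb := EuclideanDomain.gcd_eq_gcd_ab P Q
        generalize EuclideanDomain.gcdA P Q = a at *
        generalize EuclideanDomain.gcdB P Q = b at *
        generalize normalize (EuclideanDomain.gcd P Q) = N at *
        generalize EuclideanDomain.gcd P Q = g at *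
        refine ⟨a * u, b * u, mul_left_cancel₀ hm.ne_zero ?_⟩
        linear_combination (-a * u) * hP' + (-b * u) * hQ' - u * hb - hu
      have hP' : P'.Monic := hG.of_mul_monic_left hP
      have hdeg : G.natDegree + P'.natDegree = d := by rw [← hG.natDegree_mul hP', hd]
      rw [eval_mul] at h0
      refine ⟨⟨⟨G.natDegree, by omega⟩, ⟨G, hG, rfl, left_ne_zero_of_mul h0⟩,
        ⟨(P', Q'), hP', by simp only; omega, right_ne_zero_of_mul h0, ?_, hc⟩⟩, rfl⟩
      by_cases hq : Q' = 0
      · simp only [hq, degree_zero]; exact WithBot.bot_lt_coe _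
      · rw [degree_eq_natDegree (mul_ne_zero hG.ne_zero hq), natDegree_mul hG.ne_zero hq] at hQ
        have h1 : G.natDegree + Q'.natDegree < d := by exact_mod_cast hQ
        have h2 : Q'.natDegree < d - G.natDegree := by omega
        simp only
        rw [degree_eq_natDegree hq]
        exact_mod_cast h2
  have h := Nat.card_congr (Equiv.ofBijective f hf)
  rw [Nat.card_prod, ccp_card_degreeLT, Nat.card_sigma] at h
  rw [← h, ← Fin.sum_univ_eq_sum_range
    (fun k => Nat.card (CcpM F k) * Nat.card (CcpC F (d - k)))]
  simp only [Nat.card_prod]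

theorem ccp_main (F : Type*) [Field F] [Fintype F] (q : ℚ) (hq : (Fintype.card F : ℚ) = q)
    (d : ℕ) : (Nat.card (CcpC F (d + 1)) : ℚ) * (q ^ 2 - 1) =
      (q - 1) ^ 2 * (q ^ (2 * (d + 1)) - 1) := by
  have hM0 := ccp_card_M_zero F
  have hM : ∀ k, (Nat.card (CcpM F (k + 1)) : ℚ) = (q - 1) * q ^ k := by
    intro k
    rw [ccp_card_M_succ, Nat.cast_mul, Nat.cast_sub Fintype.card_pos]
    simp [hq]
  have hA : ∀ d, (Nat.card (CcpM F d) : ℚ) * q ^ d =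
      ∑ k ∈ Finset.range (d + 1), (Nat.card (CcpM F k) : ℚ) * Nat.card (CcpC F (d - k)) := by
    intro d
    have := ccp_conv F d
    rw [← hq]
    exact_mod_cast this
  generalize hc : (fun n => (Nat.card (CcpC F n) : ℚ)) = c at *
  have hc' : ∀ n, (Nat.card (CcpC F n) : ℚ) = c n := fun n => congrFun hc n
  simp only [hc'] at *
  have hA' : ∀ D, (q - 1) * q ^ D * q ^ (D + 1) =
      ∑ k ∈ Finset.range (D + 1), (q - 1) * q ^ k * c (D - k) + c (D + 1) := by
    intro D
    have := hA (D + 1)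
    rw [Finset.sum_range_succ', hM] at this
    simpa [hM, hM0] using this
  have hT : ∀ D, ∑ k ∈ Finset.range (D + 2), (q - 1) * q ^ k * c (D + 1 - k) =
      q * ∑ k ∈ Finset.range (D + 1), (q - 1) * q ^ k * c (D - k) + (q - 1) * c (D + 1) := by
    intro D
    rw [Finset.sum_range_succ', Finset.mul_sum]
    congr 1
    · apply Finset.sum_congr rfl
      intro k _
      rw [Nat.add_sub_add_right]
      ring
    · simp
  have h0 : c 0 = 1 := by
    have := hA 0
    simpa [hM0] using this.symm
  induction d with
  | zero =>
    have := hA' 0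
    simp [h0] at this
    simp only [zero_add]
    linear_combination (-(q ^ 2 - 1)) * this
  | succ d ih =>
    have h1 := hA' d
    have h2 := hA' (d + 1)
    rw [hT] at h2
    have h3 : c (d + 1 + 1) = c (d + 1) + (q - 1) ^ 2 * q ^ (2 * (d + 1)) := by
      linear_combination q * h1 - h2
    rw [h3, add_mul, ih]
    ring


/-- The number of pairs `(P, Q)` of polynomials over `F_q` with `P` monic of degree `d`,
`P(0) ≠ 0`, `deg Q < d`, and `P, Q` coprime is `(q-1)² (q^{2d}-1)/(q²-1)`. -/
theorem count_coprime_pairs (F : Type*) [Field F] [Fintype F] (q : ℕ)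
    (hq : Fintype.card F = q) (d : ℕ) (hd : 1 ≤ d) :
    (Nat.card {PQ : Polynomial F × Polynomial F //
        PQ.1.Monic ∧ PQ.1.natDegree = d ∧ PQ.1.eval 0 ≠ 0 ∧
          PQ.2.degree < d ∧ IsCoprime PQ.1 PQ.2} : ℚ) =
      ((q : ℚ) - 1) ^ 2 * (((q : ℚ) ^ (2 * d) - 1) / ((q : ℚ) ^ 2 - 1)) := by
  obtain ⟨e, rfl⟩ : ∃ e, d = e + 1 := ⟨d - 1, by omega⟩
  have h1 : 1 < Fintype.card F := Fintype.one_lt_card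
  have h2 : (1 : ℚ) < q := by rw [← hq]; exact_mod_cast h1
  have h3 : (q : ℚ) ^ 2 - 1 ≠ 0 := by nlinarith
  rw [← mul_div_assoc, eq_div_iff h3]
  exact ccp_main F q (by rw [hq]) e
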